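/- Let R be a connected locally finite graded k-algebra carrying a coherent family F of right ideals of degree ≤ d. Then the set {I(z) : I ∈ F} of Hilbert series of the ideals belonging to F is finite. -/

import Mathlib

open MulOpposite

namespace NCG

variable (k : Type) [Field k] (R : Type) [Ring R] [Algebra k R]

/-- `𝒜` is a connected grading on the `k`-algebra `R`: the graded pieces multiply
correctly, `R` is their internal direct sum, and the degree-zero piece is `k·1`. -/
def IsConnAlg (𝒜 : ℕ → Submodule k R) : Prop :=
  (∀ (i j : ℕ), ∀ x ∈ 𝒜 i, ∀ y ∈ 𝒜 j, x * y ∈ 𝒜 (i + j)) ∧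
  DirectSum.IsInternal 𝒜 ∧
  𝒜 0 = Submodule.span k {(1 : R)}

/-- `R` is locally finite: every graded piece is finite-dimensional over `k`. -/
def LocFin (𝒜 : ℕ → Submodule k R) : Prop := ∀ i, FiniteDimensional k (𝒜 i)

/-- `R` is a finitely generated `k`-algebra. -/
def FinGenAlg : Prop := ∃ s : Finset R, Algebra.adjoin k (s : Set R) = ⊤

/-- extension of the grading to `ℤ` (zero in negative degrees). -/
noncomputable def grZ (𝒜 : ℕ → Submodule k R) : ℤ → Submodule k R :=
  fun j => if 0 ≤ j then 𝒜 j.toNat else ⊥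

/-- the augmentation ideal `R_{≥1}`, as a right ideal of `R`. -/
def aug (𝒜 : ℕ → Submodule k R) : Submodule Rᵐᵒᵖ R :=
  Submodule.span Rᵐᵒᵖ (⋃ i : ℕ, ⋃ _ : 1 ≤ i, ((𝒜 i : Set R)))

variable (M : Type) [AddCommGroup M] [Module Rᵐᵒᵖ M] [Module k M]

/-- `ℳ` makes `M` a graded right module over the graded algebra `(R, 𝒜)`. -/
def IsGradedMod (𝒜 : ℕ → Submodule k R) (ℳ : ℤ → Submodule k M) : Prop :=
  (∀ (i : ℕ) (j : ℤ), ∀ r ∈ 𝒜 i, ∀ x ∈ ℳ j, (op r) • x ∈ ℳ (j + i)) ∧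
  DirectSum.IsInternal ℳ

/-- the submodule `N` of `M` is generated in degrees at most `dd`. -/
def GenLE (ℳ : ℤ → Submodule k M) (N : Submodule Rᵐᵒᵖ M) (dd : ℤ) : Prop :=
  N ≤ Submodule.span Rᵐᵒᵖ {x : M | x ∈ N ∧ ∃ j ≤ dd, x ∈ ℳ j}

/-- the submodule `N` is a graded (homogeneous) submodule of `M`. -/
def IsGradedSub (ℳ : ℤ → Submodule k M) (N : Submodule Rᵐᵒᵖ M) : Prop :=
  N ≤ Submodule.span Rᵐᵒᵖ {x : M | x ∈ N ∧ ∃ j : ℤ, x ∈ ℳ j}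

/-- the Hilbert series of a submodule `N` of `M`, as its coefficient function. -/
noncomputable def hilb (ℳ : ℤ → Submodule k M) [IsScalarTower k Rᵐᵒᵖ M]
    (N : Submodule Rᵐᵒᵖ M) : ℤ → ℕ :=
  fun j => Module.finrank k ↥(ℳ j ⊓ N.restrictScalars k)

/-- the Hilbert series of a right ideal of `R`, as its coefficient function. -/
noncomputable def hilbI (𝒜 : ℕ → Submodule k R) (I : Submodule Rᵐᵒᵖ R) : ℕ → ℕ :=
  fun j => Module.finrank k ↥(𝒜 j ⊓ I.restrictScalars k)

/-- the Hilbert series of the algebra `R`, as its coefficient function. -/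
noncomputable def hilbA (𝒜 : ℕ → Submodule k R) : ℕ → ℕ :=
  fun j => Module.finrank k ↥(𝒜 j)

/-- `v` is a solution of the homogeneous linear equation `a₁x₁ + ⋯ + aₙxₙ = 0`. -/
def IsSol {n : ℕ} (a : Fin n → M) (v : Fin n → R) : Prop :=
  ∑ i, op (v i) • a i = 0

/-- `w` is a homogeneous element of degree `j` of the free module `⊕ᵢ R(-dg i)`. -/
def FreeHomog (𝒜 : ℕ → Submodule k R) {n : ℕ} (dg : Fin n → ℤ)
    (w : Fin n → R) (j : ℤ) : Prop :=
  ∀ i, w i ∈ grZ k R 𝒜 (j - dg i)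

/-- The module of solutions of the equation with homogeneous coefficients `a` (of
degrees `dg`) is generated in degrees at most `D`: every solution is an `R`-linear
combination of homogeneous solutions of degree at most `D`. -/
def SolGenLE (𝒜 : ℕ → Submodule k R) {n : ℕ} (a : Fin n → M) (dg : Fin n → ℤ)
    (D : ℤ) : Prop :=
  ∀ v : Fin n → R, IsSol R M a v →
    v ∈ Submodule.span Rᵐᵒᵖ
      {w : Fin n → R | IsSol R M a w ∧ ∃ j ≤ D, FreeHomog k R 𝒜 dg w j}

/-- The module of solutions of the equation with coefficients `a` is generated by the
(finitely many) solutions `h`. -/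
def SolSpanBy {n : ℕ} (a : Fin n → M) {m : ℕ} (h : Fin m → (Fin n → R)) : Prop :=
  (∀ j, IsSol R M a (h j)) ∧
  ∀ v : Fin n → R, IsSol R M a v → v ∈ Submodule.span Rᵐᵒᵖ (Set.range h)

/-- `D` witnesses the effective coherence of the graded module `M`. -/
def WitnessEC (𝒜 : ℕ → Submodule k R) (ℳ : ℤ → Submodule k M) (D : ℕ → ℕ) : Prop :=
  (∀ d, d ≤ D d) ∧
  ∀ (d n : ℕ) (a : Fin n → M) (dg : Fin n → ℤ),
    (∀ i, a i ∈ ℳ (dg i)) → (∀ i, dg i ≤ (d : ℤ)) →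
    SolGenLE k R M 𝒜 a dg ((D d : ℕ) : ℤ)

/-- the graded module `M` is effectively coherent. -/
def EffCoh (𝒜 : ℕ → Submodule k R) (ℳ : ℤ → Submodule k M) : Prop :=
  ∃ D : ℕ → ℕ, WitnessEC k R M 𝒜 ℳ D

/-- the algebra `R` is effectively coherent (as a right module over itself). -/
noncomputable def EffCohAlg (𝒜 : ℕ → Submodule k R) : Prop :=
  EffCoh k R R 𝒜 (grZ k R 𝒜)

/-- `M` is a finitely presented graded right `R`-module. -/
def ModFinPres (𝒜 : ℕ → Submodule k R) (ℳ : ℤ → Submodule k M) : Prop :=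
  ∃ (t : ℕ) (b : Fin t → M) (db : Fin t → ℤ),
    (∀ i, b i ∈ ℳ (db i)) ∧ Submodule.span Rᵐᵒᵖ (Set.range b) = ⊤ ∧
    ∃ (m : ℕ) (h : Fin m → (Fin t → R)) (e : Fin m → ℤ),
      (∀ j, FreeHomog k R 𝒜 db (h j) (e j)) ∧ SolSpanBy R M b h

/-- `R` is a finitely presented algebra: there is an exact sequence
`F₂ → F₁ → R → k_R → 0` of graded right modules with `F₁, F₂` finite graded free. -/
def AlgFinPres (𝒜 : ℕ → Submodule k R) : Prop :=
  ∃ (n : ℕ) (g : Fin n → R) (dg : Fin n → ℕ),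
    (∀ i, g i ∈ 𝒜 (dg i)) ∧
    Submodule.span Rᵐᵒᵖ (Set.range g) = aug k R 𝒜 ∧
    ∃ (m : ℕ) (h : Fin m → (Fin n → R)) (e : Fin m → ℤ),
      (∀ j, FreeHomog k R 𝒜 (fun i => (dg i : ℤ)) (h j) (e j)) ∧
      SolSpanBy R R g h

/-- `R` admits an exact sequence `F₃ → F₂ → F₁ → R → k_R → 0` of graded right modules
with all `Fᵢ` finite graded free (finitely presented with `dim Tor₃ < ∞`). -/
def AlgFinPres3 (𝒜 : ℕ → Submodule k R) : Prop :=
  ∃ (n : ℕ) (g : Fin n → R) (dg : Fin n → ℕ),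
    (∀ i, g i ∈ 𝒜 (dg i)) ∧
    Submodule.span Rᵐᵒᵖ (Set.range g) = aug k R 𝒜 ∧
    ∃ (m : ℕ) (h : Fin m → (Fin n → R)) (e : Fin m → ℤ),
      (∀ j, FreeHomog k R 𝒜 (fun i => (dg i : ℤ)) (h j) (e j)) ∧
      SolSpanBy R R g h ∧
      ∃ (p : ℕ) (u : Fin p → (Fin m → R)) (f : Fin p → ℤ),
        (∀ l, FreeHomog k R 𝒜 e (u l) (f l)) ∧
        SolSpanBy R (Fin n → R) h u

/-- membership in the class `D(n,a,b,c)`: there is an exact sequence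
`F₃ → F₂ → F₁ → R → k_R → 0` with `F₁` of rank at most `n` and basis in degrees `≤ a`,
`F₂` with basis in degrees `≤ b` and `F₃` with basis in degrees `≤ c`. -/
def InDClass (𝒜 : ℕ → Submodule k R) (n a b c : ℕ) : Prop :=
  ∃ (n' : ℕ), n' ≤ n ∧ ∃ (g : Fin n' → R) (dg : Fin n' → ℕ),
    (∀ i, dg i ≤ a) ∧ (∀ i, g i ∈ 𝒜 (dg i)) ∧
    Submodule.span Rᵐᵒᵖ (Set.range g) = aug k R 𝒜 ∧
    ∃ (m : ℕ) (h : Fin m → (Fin n' → R)) (e : Fin m → ℤ),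
      (∀ j, e j ≤ (b : ℤ)) ∧
      (∀ j, FreeHomog k R 𝒜 (fun i => (dg i : ℤ)) (h j) (e j)) ∧
      SolSpanBy R R g h ∧
      SolGenLE k R (Fin n' → R) 𝒜 h e (c : ℤ)

/-- the right ideal `I` has a finite homogeneous generating family in degrees `≤ d`. -/
def FinGenLE (𝒜 : ℕ → Submodule k R) (I : Submodule Rᵐᵒᵖ R) (d : ℕ) : Prop :=
  ∃ (n : ℕ) (x : Fin n → R) (dx : Fin n → ℕ),
    (∀ i, dx i ≤ d) ∧ (∀ i, x i ∈ 𝒜 (dx i)) ∧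
    Submodule.span Rᵐᵒᵖ (Set.range x) = I

/-- lexicographic strict order on `ℕ`-indexed coefficient functions: `f <_lex g`. -/
def LexLtN (f g : ℕ → ℕ) : Prop := ∃ q, (∀ i < q, f i = g i) ∧ f q < g q

/-- lexicographic strict order on `ℤ`-indexed coefficient functions: `f <_lex g`. -/
def LexLtZ (f g : ℤ → ℕ) : Prop := ∃ q, (∀ i < q, f i = g i) ∧ f q < g q

/-- the right annihilator ideal of an element `a : R`. -/
def rAnn (a : R) : Submodule Rᵐᵒᵖ R where
  carrier := {r : R | a * r = 0}
  add_mem' := by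
    intro x y hx hy
    simp only [Set.mem_setOf_eq] at *
    rw [mul_add, hx, hy, add_zero]
  zero_mem' := by simp
  smul_mem' := by
    intro c x hx
    simp only [Set.mem_setOf_eq] at *
    rw [← op_unop c, op_smul_eq_mul, ← mul_assoc, hx, zero_mul]

/-- the colon right ideal `(x : J) = { a ∈ R | x·a ∈ J }`. -/
def colon (x : R) (J : Submodule Rᵐᵒᵖ R) : Submodule Rᵐᵒᵖ R where
  carrier := {a : R | x * a ∈ J}
  add_mem' := by
    intro p q hp hq
    simp only [Set.mem_setOf_eq] at *
    rw [mul_add]; exact J.add_mem hp hq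
  zero_mem' := by simp
  smul_mem' := by
    intro c p hp
    simp only [Set.mem_setOf_eq] at *
    rw [← op_unop c, op_smul_eq_mul, ← mul_assoc]
    exact J.smul_mem (op (unop c)) hp

/-- `F` is a coherent family of right ideals of `R`. -/
def IsCohFam (𝒜 : ℕ → Submodule k R) (F : Set (Submodule Rᵐᵒᵖ R)) : Prop :=
  (∀ I ∈ F, I.FG ∧ IsGradedSub k R R (grZ k R 𝒜) I) ∧
  (⊥ : Submodule Rᵐᵒᵖ R) ∈ F ∧ aug k R 𝒜 ∈ F ∧
  ∀ I ∈ F, I ≠ ⊥ → ∃ J ∈ F, J ≠ I ∧ ∃ x : R, (∃ dx : ℕ, x ∈ 𝒜 dx) ∧ x ∈ I ∧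
    I = J ⊔ Submodule.span Rᵐᵒᵖ {x} ∧
    (∀ dI : ℤ, GenLE k R R (grZ k R 𝒜) I dI → GenLE k R R (grZ k R 𝒜) J dI) ∧
    colon R x J ∈ F

/-- the family `F` of ideals has degree at most `d`. -/
def CohFamDegLE (𝒜 : ℕ → Submodule k R) (F : Set (Submodule Rᵐᵒᵖ R)) (d : ℕ) : Prop :=
  ∀ I ∈ F, GenLE k R R (grZ k R 𝒜) I (d : ℤ)

/-- the right ideal `I` is finitely presented as a graded module. -/
def IdealFinPres (𝒜 : ℕ → Submodule k R) (I : Submodule Rᵐᵒᵖ R) : Prop :=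
  ∃ (n : ℕ) (x : Fin n → R) (dx : Fin n → ℕ),
    (∀ i, x i ∈ 𝒜 (dx i)) ∧ Submodule.span Rᵐᵒᵖ (Set.range x) = I ∧
    ∃ (m : ℕ) (h : Fin m → (Fin n → R)) (e : Fin m → ℤ),
      (∀ j, FreeHomog k R 𝒜 (fun i => (dx i : ℤ)) (h j) (e j)) ∧
      SolSpanBy R R x h

/-- `R` is graded right coherent: every finitely generated homogeneous right ideal
is finitely presented as a graded module. -/
def GradedCoherent (𝒜 : ℕ → Submodule k R) : Prop :=
  ∀ I : Submodule Rᵐᵒᵖ R, I.FG → IsGradedSub k R R (grZ k R 𝒜) I →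
    IdealFinPres k R 𝒜 I

/-- a free resolution of the right ideal `I` by finite graded free modules whose
bases at level `i` sit in degrees at most `B i`. -/
def FreeResBdd (𝒜 : ℕ → Submodule k R) (I : Submodule Rᵐᵒᵖ R) (B : ℕ → ℤ) : Prop :=
  ∃ (r : ℕ → ℕ) (dgs : (i : ℕ) → Fin (r i) → ℤ)
    (g0 : Fin (r 0) → R)
    (g : (i : ℕ) → Fin (r (i + 1)) → (Fin (r i) → R)),
    (∀ l, dgs 0 l ≤ B 0) ∧
    (∀ l, g0 l ∈ grZ k R 𝒜 (dgs 0 l)) ∧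
    Submodule.span Rᵐᵒᵖ (Set.range g0) = I ∧
    (∀ (i : ℕ) (l : Fin (r (i + 1))), dgs (i + 1) l ≤ B (i + 1)) ∧
    (∀ (i : ℕ) (l : Fin (r (i + 1))), FreeHomog k R 𝒜 (dgs i) (g i l) (dgs (i + 1) l)) ∧
    SolSpanBy R R g0 (g 0) ∧
    (∀ i : ℕ, SolSpanBy R (Fin (r i) → R) (g i) (g (i + 1)))

/-- the Artin–Zhang property for a graded module `M`. -/
def ArtinZhang (ℳ : ℤ → Submodule k M) [IsScalarTower k Rᵐᵒᵖ M] : Prop :=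
  ∀ h : ℤ → ℕ, ∃ d : ℤ, 0 < d ∧
    (∀ L : Submodule Rᵐᵒᵖ M, L.FG → hilb k R M ℳ L = h → GenLE k R M ℳ L d) ∧
    (∀ L : Submodule Rᵐᵒᵖ M, GenLE k R M ℳ L d →
      (∀ j ≤ d, hilb k R M ℳ L j = h j) → hilb k R M ℳ L = h)

/-- `M` is effective for series: for each `d`, only finitely many Hilbert series of
submodules generated in degrees `≤ d`. -/
def EffForSeries (ℳ : ℤ → Submodule k M) [IsScalarTower k Rᵐᵒᵖ M] : Prop :=
  ∀ d : ℤ, {h : ℤ → ℕ | ∃ L : Submodule Rᵐᵒᵖ M,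
    GenLE k R M ℳ L d ∧ h = hilb k R M ℳ L}.Finite

/-- `M` is effective for generators: the Hilbert series of a finitely generated
submodule bounds the degrees of its generators. -/
def EffForGen (ℳ : ℤ → Submodule k M) [IsScalarTower k Rᵐᵒᵖ M] : Prop :=
  ∀ h : ℤ → ℕ, ∃ d : ℤ,
    ∀ L : Submodule Rᵐᵒᵖ M, L.FG → hilb k R M ℳ L = h → GenLE k R M ℳ L d

/-- bundled data of a graded `k`-algebra. -/
structure AlgData (k : Type) [Field k] : Type 1 where
  carrier : Type
  [ringStr : Ring carrier]
  [algStr : Algebra k carrier]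
  grading : ℕ → Submodule k carrier

attribute [instance] AlgData.ringStr AlgData.algStr

/-- bundled data of a graded right `R`-module. -/
structure ModData (k R : Type) [Field k] [Ring R] [Algebra k R] : Type 1 where
  carrier : Type
  [acg : AddCommGroup carrier]
  [modR : Module Rᵐᵒᵖ carrier]
  [modk : Module k carrier]
  [tower : IsScalarTower k Rᵐᵒᵖ carrier]
  grading : ℤ → Submodule k carrier

attribute [instance] ModData.acg ModData.modR ModData.modk ModData.tower


/-! ### Helper lemmas -/

/-- Hilbert basis theorem: eventual vanishing can be made simultaneous. -/
theorem eventually_all_vanish {K : Type} [Field K] {α σ : Type} [Finite σ] (U : Filter α)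
    (q : α → σ → K) (S : Set (MvPolynomial σ K))
    (hS : ∀ P ∈ S, ∀ᶠ m in U, MvPolynomial.eval (q m) P = 0) :
    ∀ᶠ m in U, ∀ P ∈ S, MvPolynomial.eval (q m) P = 0 := by
  obtain ⟨T, hT⟩ : (Ideal.span S).FG := IsNoetherian.noetherian _
  have h1 : ∀ P ∈ Ideal.span S, ∀ᶠ m in U, MvPolynomial.eval (q m) P = 0 := by
    intro P hP
    induction hP using Submodule.span_induction with
    | mem x h => exact hS x h
    | zero => simp
    | add x y _ _ hx hy =>
      filter_upwards [hx, hy] with m h1 h2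
      simp [h1, h2]
    | smul a x _ hx =>
      filter_upwards [hx] with m h1
      simp [h1]
  have h2 : ∀ᶠ m in U, ∀ P ∈ T, MvPolynomial.eval (q m) P = 0 := by
    rw [Filter.eventually_all_finset]
    intro P hP
    exact h1 P (hT ▸ Ideal.subset_span hP)
  filter_upwards [h2] with m hm P hP
  have hle : Ideal.span S ≤ RingHom.ker (MvPolynomial.eval (q m)) := by
    rw [← hT, Submodule.span_le]
    intro Q hQ
    exact hm Q hQ
  exact hle (Ideal.subset_span hP)

/-- a right ideal generated by its intersection with a finite-dimensional space is generated by
a fixed number of elements. -/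
theorem exists_coords (E : Submodule k R) {n : ℕ} (b : Module.Basis (Fin n) k E)
    (I : Submodule Rᵐᵒᵖ R) (hI : I ≤ Submodule.span Rᵐᵒᵖ {x : R | x ∈ I ∧ x ∈ E}) :
    ∃ q : Fin n × Fin n → k,
      I = Submodule.span Rᵐᵒᵖ (Set.range fun a => ∑ t, q (a, t) • (b t : R)) := by
  let S : Submodule k E := (I.restrictScalars k).comap E.subtype
  obtain ⟨φ, hφ⟩ := LinearMap.exists_leftInverse_of_injective (K := k) (V := S) (V' := E)
    S.subtype (Submodule.ker_subtype S)
  have key : ∀ a, ∑ t, (b.repr (φ (b a) : E) t) • (b t : R) = ((φ (b a) : E) : R) := by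
    intro a
    have := congrArg E.subtype (b.sum_repr (φ (b a) : E))
    rw [map_sum] at this
    exact this
  refine ⟨fun p => b.repr (φ (b p.1) : E) p.2, ?_⟩
  simp only [key]
  apply le_antisymm
  · refine hI.trans (Submodule.span_le.2 ?_)
    rintro x ⟨hxI, hxE⟩
    let s : S := ⟨⟨x, hxE⟩, hxI⟩
    have h1 : φ (s : E) = s := by
      have := LinearMap.congr_fun hφ s
      simpa using this
    have h2 : x = ∑ a, (b.repr (s : E) a) • ((φ (b a) : E) : R) := by
      have h3 : φ (∑ a, b.repr (s : E) a • b a) = s := by rw [b.sum_repr, h1]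
      rw [map_sum] at h3
      have := congrArg (fun z : S => ((z : E) : R)) h3
      simp only [map_smul] at this
      simpa [s] using this.symm
    rw [h2]
    refine Submodule.sum_mem _ fun a _ => ?_
    exact Submodule.smul_of_tower_mem _ _ (Submodule.subset_span ⟨a, rfl⟩)
  · refine Submodule.span_le.2 ?_
    rintro _ ⟨a, rfl⟩
    exact (φ (b a)).2

/-- along an ultrafilter, the Hilbert functions converge from below. -/
theorem limit_from_below {α : Type} (U : Ultrafilter α) (E : Submodule k R)
    [FiniteDimensional k E] (I : α → Submodule Rᵐᵒᵖ R)
    (hI : ∀ m, I m ≤ Submodule.span Rᵐᵒᵖ {x : R | x ∈ I m ∧ x ∈ E})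
    (π : ℕ → R →ₗ[k] R) (hπ : ∀ j, FiniteDimensional k (LinearMap.range (π j))) :
    ∃ g : ℕ → ℕ,
      (∀ j, ∀ᶠ m in U, Module.finrank k (((I m).restrictScalars k).map (π j)) = g j) ∧
      ∀ᶠ m in U, ∀ j, Module.finrank k (((I m).restrictScalars k).map (π j)) ≤ g j := by
  have hfd : ∀ j m, FiniteDimensional k (((I m).restrictScalars k).map (π j)) := fun j m =>
    Submodule.finiteDimensional_of_le (LinearMap.map_le_range)
  have h1 : ∀ j, ∃ c,
      ∀ᶠ m in U, Module.finrank k (((I m).restrictScalars k).map (π j)) = c := by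
    intro j
    have := (Ultrafilter.eventually_exists_mem_iff (f := U)
      (is := Set.Iic (Module.finrank k (LinearMap.range (π j))))
      (P := fun c m => Module.finrank k (((I m).restrictScalars k).map (π j)) = c)
      (Set.finite_Iic _)).1 (Filter.Eventually.of_forall fun m =>
        ⟨_, Submodule.finrank_mono (LinearMap.map_le_range), rfl⟩)
    obtain ⟨c, -, hc⟩ := this
    exact ⟨c, hc⟩
  choose g hg using h1
  refine ⟨g, hg, ?_⟩
  let n := Module.finrank k E
  let b : Module.Basis (Fin n) k E := Module.finBasis k E
  choose q hq using fun m => exists_coords k R E b (I m) (hI m)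
  -- the determinantal polynomials
  let A : (j : ℕ) → (Fin (g j + 1) → Fin n → R) → (Fin (g j + 1) → (R →ₗ[k] k)) →
      Matrix (Fin (g j + 1)) (Fin (g j + 1)) (MvPolynomial (Fin n × Fin n) k) := fun j r l =>
    Matrix.of fun a c => ∑ i, ∑ t, MvPolynomial.X (i, t) *
      MvPolynomial.C (l c (π j ((b t : R) * r a i)))
  have hA : ∀ j r l m, MvPolynomial.eval (q m) (A j r l).det =
      (Matrix.of fun a c =>
        l c (π j (∑ i, (∑ t, q m (i, t) • (b t : R)) * r a i))).det := by
    intro j r l m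
    rw [RingHom.map_det]
    congr 1
    ext a c
    simp [A, Finset.sum_mul, map_sum]
  have hmem : ∀ m y, y ∈ I m ↔ ∃ r : Fin n → R,
      ∑ i, (∑ t, q m (i, t) • (b t : R)) * r i = y := by
    intro m y
    conv_lhs => rw [hq m]
    rw [Submodule.mem_span_range_iff_exists_fun]
    constructor
    · rintro ⟨c, hc⟩
      refine ⟨fun i => unop (c i), ?_⟩
      rw [← hc]
      refine Finset.sum_congr rfl fun i _ => ?_
      rw [← op_smul_eq_mul, op_unop]
    · rintro ⟨r, hr⟩
      exact ⟨fun i => op (r i), by simpa [op_smul_eq_mul] using hr⟩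
  have hev := eventually_all_vanish (U : Filter α) q
    {P | ∃ j r l, P = (A j r l).det} (by
      rintro P ⟨j, r, l, rfl⟩
      filter_upwards [hg j] with m hm
      by_contra hne
      rw [hA] at hne
      have hli := Matrix.linearIndependent_rows_of_det_ne_zero hne
      let y : Fin (g j + 1) → ((I m).restrictScalars k).map (π j) := fun a =>
        ⟨π j (∑ i, (∑ t, q m (i, t) • (b t : R)) * r a i),
          Submodule.mem_map_of_mem ((hmem m _).2 ⟨r a, rfl⟩)⟩
      have hy : LinearIndependent k y :=
        LinearIndependent.of_comp ((LinearMap.pi l).comp (Submodule.subtype _)) hli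
      haveI := hfd j m
      have := hy.fintype_card_le_finrank
      rw [hm] at this
      simp at this)
  filter_upwards [hev] with m hm j
  by_contra hlt
  push Not at hlt
  haveI := hfd j m
  let B := Module.finBasis k (((I m).restrictScalars k).map (π j))
  let y : Fin (g j + 1) → R := fun a => (B (Fin.castLE hlt a) : R)
  have hy : LinearIndependent k y :=
    (B.linearIndependent.map' (Submodule.subtype _) (Submodule.ker_subtype _)).comp _
      (Fin.castLE_injective hlt)
  obtain ⟨L, hL⟩ := LinearMap.exists_leftInverse_of_injective
    (Fintype.linearCombination k y) (by
      rw [LinearMap.ker_eq_bot]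
      exact linearIndependent_iff_injective_fintypeLinearCombination.1 hy)
  have hLy : ∀ a, L (y a) = Pi.single a 1 := by
    intro a
    have := LinearMap.congr_fun hL (Pi.single a 1)
    simpa [Fintype.linearCombination_apply_single] using this
  have hyr : ∀ a, ∃ r : Fin n → R,
      π j (∑ i, (∑ t, q m (i, t) • (b t : R)) * r i) = y a := by
    intro a
    obtain ⟨z, hz, hz'⟩ := (B (Fin.castLE hlt a)).2
    obtain ⟨r, hr⟩ := (hmem m z).1 hz
    exact ⟨r, by rw [hr, hz']⟩
  choose r hr using hyr
  have h0 := hm _ ⟨j, r, fun c => (LinearMap.proj c).comp L, rfl⟩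
  rw [hA] at h0
  have h1 : (Matrix.of fun a c => ((LinearMap.proj c).comp L)
      (π j (∑ i, (∑ t, q m (i, t) • (b t : R)) * r a i)) :
      Matrix (Fin (g j + 1)) (Fin (g j + 1)) k) = 1 := by
    ext a c
    simp only [Matrix.of_apply, hr, LinearMap.comp_apply, hLy, LinearMap.proj_apply]
    rw [Matrix.one_apply, Pi.single_apply]
    simp [eq_comm]
  rw [h1, Matrix.det_one] at h0
  exact one_ne_zero h0

/-- the projections on the graded components. -/
theorem exists_proj (𝒜 : ℕ → Submodule k R) (hconn : IsConnAlg k R 𝒜) :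
    ∃ π : ℕ → R →ₗ[k] R, (∀ j y, π j y ∈ 𝒜 j) ∧ (∀ j, ∀ y ∈ 𝒜 j, π j y = y) ∧
      (∀ i j, ∀ x ∈ 𝒜 i, ∀ r, i ≤ j → π j (x * r) = x * π (j - i) r) ∧
      (∀ i j, ∀ x ∈ 𝒜 i, ∀ r, ¬ i ≤ j → π j (x * r) = 0) := by
  obtain ⟨hmul, hint, h0⟩ := hconn
  letI : DirectSum.Decomposition 𝒜 := hint.chooseDecomposition
  letI : SetLike.GradedMonoid 𝒜 :=
    { one_mem := by rw [h0]; exact Submodule.mem_span_singleton_self 1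
      mul_mem := fun i j x y hx hy => hmul i j x hx y hy }
  letI : GradedAlgebra 𝒜 := { }
  refine ⟨fun j => GradedAlgebra.proj 𝒜 j, ?_, ?_, ?_, ?_⟩
  · intro j y
    rw [GradedAlgebra.proj_apply]
    exact SetLike.coe_mem _
  · intro j y hy
    rw [GradedAlgebra.proj_apply]
    exact DirectSum.decompose_of_mem_same 𝒜 hy
  · intro i j x hx r hij
    rw [GradedAlgebra.proj_apply, GradedAlgebra.proj_apply]
    exact DirectSum.coe_decompose_mul_of_left_mem_of_le 𝒜 hx hij
  · intro i j x hx r hij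
    rw [GradedAlgebra.proj_apply]
    exact DirectSum.coe_decompose_mul_of_left_mem_of_not_le 𝒜 hx hij

/-- homogeneous ideals are stable under the projections. -/
theorem proj_mem (𝒜 : ℕ → Submodule k R) (π : ℕ → R →ₗ[k] R)
    (h3 : ∀ i j, ∀ x ∈ 𝒜 i, ∀ r, i ≤ j → π j (x * r) = x * π (j - i) r)
    (h4 : ∀ i j, ∀ x ∈ 𝒜 i, ∀ r, ¬ i ≤ j → π j (x * r) = 0)
    (I : Submodule Rᵐᵒᵖ R) (hI : IsGradedSub k R R (grZ k R 𝒜) I) (j : ℕ) (y : R)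
    (hy : y ∈ I) : π j y ∈ I := by
  have hy' := hI hy
  rw [Submodule.mem_span_set'] at hy'
  obtain ⟨n, f, g, rfl⟩ := hy'
  rw [map_sum]
  refine Submodule.sum_mem _ fun a _ => ?_
  obtain ⟨hg1, i, hg2⟩ := (g a).2
  have hop : f a • (g a : R) = (g a : R) * unop (f a) := by
    rw [← op_smul_eq_mul, op_unop]
  rw [hop]
  unfold grZ at hg2
  split_ifs at hg2 with h
  · by_cases hij : i.toNat ≤ j
    · rw [h3 _ _ _ hg2 _ hij, ← op_smul_eq_mul]
      exact I.smul_mem _ hg1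
    · rw [h4 _ _ _ hg2 _ hij]
      exact I.zero_mem
  · have : (g a : R) = 0 := by simpa using hg2
    rw [this]
    simp

theorem finrank_map_add {V W : Type} [AddCommGroup V] [Module k V] [AddCommGroup W] [Module k W]
    (f : V →ₗ[k] W) (S : Submodule k V) [FiniteDimensional k S] :
    Module.finrank k (S.map f) + Module.finrank k ↥(S ⊓ LinearMap.ker f) =
      Module.finrank k S := by
  have h := LinearMap.finrank_range_add_finrank_ker (f.domRestrict S)
  rw [LinearMap.range_domRestrict] at h
  rw [← h, LinearMap.ker_domRestrict]
  congr 1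
  have := (Submodule.equivSubtypeMap S ((LinearMap.ker f).comap S.subtype)).finrank_eq
  rw [Submodule.map_comap_subtype] at this
  exact this.symm

theorem mem_sup_span (I J : Submodule Rᵐᵒᵖ R) (x : R)
    (hI : I = J ⊔ Submodule.span Rᵐᵒᵖ {x}) (y : R) (hy : y ∈ I) :
    ∃ a ∈ J, ∃ r : R, y = a + x * r := by
  rw [hI, Submodule.mem_sup] at hy
  obtain ⟨a, ha, z, hz, rfl⟩ := hy
  obtain ⟨c, rfl⟩ := Submodule.mem_span_singleton.1 hz
  exact ⟨a, ha, unop c, by rw [← op_smul_eq_mul, op_unop]⟩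

/-- the exact sequence `0 → J → I → R/(x:J)(-e) → 0` in each degree. -/
theorem hilb_step (𝒜 : ℕ → Submodule k R) (hlf : LocFin k R 𝒜)
    (hmul : ∀ (i j : ℕ), ∀ x ∈ 𝒜 i, ∀ y ∈ 𝒜 j, x * y ∈ 𝒜 (i + j))
    (π : ℕ → R →ₗ[k] R)
    (h1 : ∀ j y, π j y ∈ 𝒜 j) (h2 : ∀ j, ∀ y ∈ 𝒜 j, π j y = y)
    (h3 : ∀ i j, ∀ x ∈ 𝒜 i, ∀ r, i ≤ j → π j (x * r) = x * π (j - i) r)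
    (I J : Submodule Rᵐᵒᵖ R) (hJ : ∀ j, ∀ y ∈ J, π j y ∈ J) (x : R) (e : ℕ) (hx : x ∈ 𝒜 e)
    (hIJ : I = J ⊔ Submodule.span Rᵐᵒᵖ {x}) (j : ℕ) (hj : e ≤ j) :
    hilbI k R 𝒜 I j + hilbI k R 𝒜 (colon R x J) (j - e) =
      hilbI k R 𝒜 J j + hilbA k R 𝒜 (j - e) := by
  haveI := hlf j
  haveI := hlf (j - e)
  have hJI : J ≤ I := hIJ ▸ le_sup_left
  have hxI : x ∈ I := hIJ ▸ (le_sup_right : _ ≤ J ⊔ _) (Submodule.mem_span_singleton_self x)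
  have hxr : ∀ r, x * r ∈ I := fun r => by
    rw [← op_smul_eq_mul]; exact I.smul_mem _ hxI
  let Jk := J.restrictScalars k
  let ψ : R →ₗ[k] R ⧸ Jk := Jk.mkQ.comp (LinearMap.mulLeft k x)
  haveI : FiniteDimensional k ↥(𝒜 j ⊓ I.restrictScalars k) :=
    Submodule.finiteDimensional_of_le inf_le_left
  have e1 := finrank_map_add k ψ (𝒜 (j - e))
  have e2 := finrank_map_add k Jk.mkQ (𝒜 j ⊓ I.restrictScalars k)
  have e3 : LinearMap.ker ψ = (colon R x J).restrictScalars k := by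
    ext r
    simp only [ψ, LinearMap.mem_ker, LinearMap.comp_apply, LinearMap.mulLeft_apply,
      Submodule.mkQ_apply, Submodule.Quotient.mk_eq_zero]
    rfl
  have e4 : (𝒜 j ⊓ I.restrictScalars k) ⊓ LinearMap.ker Jk.mkQ = 𝒜 j ⊓ Jk := by
    rw [Submodule.ker_mkQ, inf_assoc]
    congr 1
    exact inf_eq_right.2 hJI
  have e5 : (𝒜 j ⊓ I.restrictScalars k).map Jk.mkQ = (𝒜 (j - e)).map ψ := by
    apply le_antisymm
    · rintro _ ⟨y, ⟨hyj, hyI⟩, rfl⟩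
      obtain ⟨a, ha, r, hr⟩ := mem_sup_span R I J x hIJ y hyI
      refine ⟨π (j - e) r, h1 _ _, ?_⟩
      have hy : y = π j a + x * π (j - e) r := by
        rw [← h3 e j x hx r hj, ← map_add, ← hr, h2 j y hyj]
      have h0 : Jk.mkQ (π j a) = 0 := by
        rw [Submodule.mkQ_apply, Submodule.Quotient.mk_eq_zero]
        exact hJ j a ha
      rw [hy, map_add, h0, zero_add]
      rfl
    · rintro _ ⟨r, hr, rfl⟩
      refine ⟨x * r, ⟨?_, hxr r⟩, rfl⟩
      have := hmul e (j - e) x hx r hr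
      rwa [Nat.add_sub_cancel' hj] at this
  rw [e3] at e1
  rw [e4, e5] at e2
  unfold hilbI hilbA
  change Module.finrank k ↥(𝒜 j ⊓ I.restrictScalars k) + _ =
    Module.finrank k ↥(𝒜 j ⊓ Jk) + _
  omega

theorem low_step (𝒜 : ℕ → Submodule k R) (π : ℕ → R →ₗ[k] R)
    (h2 : ∀ j, ∀ y ∈ 𝒜 j, π j y = y)
    (h4 : ∀ i j, ∀ x ∈ 𝒜 i, ∀ r, ¬ i ≤ j → π j (x * r) = 0)
    (I J : Submodule Rᵐᵒᵖ R) (hJ : ∀ j, ∀ y ∈ J, π j y ∈ J) (x : R) (e : ℕ) (hx : x ∈ 𝒜 e)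
    (hIJ : I = J ⊔ Submodule.span Rᵐᵒᵖ {x}) (j : ℕ) (hj : ¬ e ≤ j) :
    𝒜 j ⊓ I.restrictScalars k = 𝒜 j ⊓ J.restrictScalars k := by
  have hJI : J ≤ I := hIJ ▸ le_sup_left
  apply le_antisymm
  · rintro y ⟨hyj, hyI⟩
    refine ⟨hyj, ?_⟩
    obtain ⟨a, ha, r, hr⟩ := mem_sup_span R I J x hIJ y hyI
    have : y = π j a := by
      rw [← h2 j y hyj, hr, map_add, h4 e j x hx r hj, add_zero]
    rw [this]
    exact hJ j a ha
  · exact inf_le_inf_left _ hJI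

/-- an ideal generated in degrees at most `d` is determined by its components up to `d`. -/
theorem le_of_low (𝒜 : ℕ → Submodule k R) (d : ℕ) (I J : Submodule Rᵐᵒᵖ R)
    (hI : GenLE k R R (grZ k R 𝒜) I (d : ℤ))
    (h : ∀ j ≤ d, 𝒜 j ⊓ I.restrictScalars k ≤ J.restrictScalars k) : I ≤ J := by
  refine le_trans hI (Submodule.span_le.2 ?_)
  rintro x ⟨hxI, j, hj, hx⟩
  unfold grZ at hx
  split_ifs at hx with h0
  · exact h j.toNat (by omega) ⟨hx, hxI⟩
  · have : x = 0 := by simpa using hx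
    rw [this]
    exact J.zero_mem

/-- the set of Hilbert series of the ideals of a coherent family of
degree at most `d` is finite. -/
theorem statement_15 (k R : Type) [Field k] [Ring R] [Algebra k R]
    (𝒜 : ℕ → Submodule k R) (hconn : IsConnAlg k R 𝒜) (hlf : LocFin k R 𝒜)
    (F : Set (Submodule Rᵐᵒᵖ R)) (d : ℕ)
    (hF : IsCohFam k R 𝒜 F) (hdeg : CohFamDegLE k R 𝒜 F d) :
    {h : ℕ → ℕ | ∃ I ∈ F, h = hilbI k R 𝒜 I}.Finite := by
  obtain ⟨π, h1, h2, h3, h4⟩ := exists_proj k R 𝒜 hconn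
  obtain ⟨hmul, -, -⟩ := hconn
  obtain ⟨hgr, hbot, -, hstep⟩ := hF
  have hpm : ∀ I ∈ F, ∀ j, ∀ y ∈ I, π j y ∈ I := fun I hI j y hy =>
    proj_mem k R 𝒜 π h3 h4 I (hgr I hI).2 j y hy
  have hπfd : ∀ j, FiniteDimensional k (LinearMap.range (π j)) := by
    intro j
    haveI := hlf j
    refine Submodule.finiteDimensional_of_le (S₂ := 𝒜 j) ?_
    rintro _ ⟨y, rfl⟩
    exact h1 j y
  have hhil : ∀ I ∈ F, ∀ j,
      hilbI k R 𝒜 I j = Module.finrank k ((I.restrictScalars k).map (π j)) := by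
    intro I hI j
    unfold hilbI
    have : 𝒜 j ⊓ I.restrictScalars k = (I.restrictScalars k).map (π j) := by
      apply le_antisymm
      · rintro y ⟨hyj, hyI⟩
        exact ⟨y, hyI, h2 j y hyj⟩
      · rintro _ ⟨y, hy, rfl⟩
        exact ⟨h1 j y, hpm I hI j y hy⟩
    rw [this]
  -- the finite-dimensional space of elements of degree at most `d`
  let E : Submodule k R := (Finset.range (d + 1)).sup 𝒜
  haveI : ∀ i, FiniteDimensional k (𝒜 i) := hlf
  haveI hE : FiniteDimensional k E := Submodule.finiteDimensional_finset_sup _ _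
  have hEgen : ∀ I ∈ F, I ≤ Submodule.span Rᵐᵒᵖ {x : R | x ∈ I ∧ x ∈ E} := by
    intro I hI
    refine le_of_low k R 𝒜 d I _ (hdeg I hI) ?_
    rintro j hj y ⟨hyj, hyI⟩
    refine Submodule.subset_span ⟨hyI, ?_⟩
    have : 𝒜 j ≤ E := Finset.le_sup (f := 𝒜) (Finset.mem_range.2 (by omega))
    exact this hyj
  have hlim : ∀ (U : Ultrafilter ℕ) (I : ℕ → Submodule Rᵐᵒᵖ R), (∀ m, I m ∈ F) →
      ∃ g : ℕ → ℕ, (∀ j, ∀ᶠ m in U, hilbI k R 𝒜 (I m) j = g j) ∧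
        ∀ᶠ m in U, ∀ j, hilbI k R 𝒜 (I m) j ≤ g j := by
    intro U I hI
    have := limit_from_below k R U E I (fun m => hEgen _ (hI m)) π hπfd
    simpa only [← hhil _ (hI _)] using this
  let s : Submodule Rᵐᵒᵖ R → ℕ := fun I => ∑ j ∈ Finset.range (d + 1), hilbI k R 𝒜 I j
  have hfdI : ∀ (I : Submodule Rᵐᵒᵖ R) j, FiniteDimensional k ↥(𝒜 j ⊓ I.restrictScalars k) :=
    fun I j => Submodule.finiteDimensional_of_le inf_le_left
  have hslt : ∀ I ∈ F, ∀ J : Submodule Rᵐᵒᵖ R, J ≤ I → J ≠ I → s J < s I := by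
    intro I hI J hJI hne
    have hmono : ∀ j, hilbI k R 𝒜 J j ≤ hilbI k R 𝒜 I j := by
      intro j
      haveI := hfdI I j
      exact Submodule.finrank_mono (inf_le_inf_left _ hJI)
    by_contra hlt
    apply hne
    refine le_antisymm hJI (le_of_low k R 𝒜 d I J (hdeg I hI) ?_)
    intro j hj
    have hle : hilbI k R 𝒜 I j ≤ hilbI k R 𝒜 J j := by
      by_contra hc
      apply hlt
      exact Finset.sum_lt_sum (fun i _ => hmono i)
        ⟨j, Finset.mem_range.2 (by omega), by omega⟩
    haveI := hfdI I j
    have := Submodule.eq_of_le_of_finrank_le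
      (show 𝒜 j ⊓ J.restrictScalars k ≤ 𝒜 j ⊓ I.restrictScalars k from
        inf_le_inf_left _ hJI) hle
    rw [← this]
    exact inf_le_right
  have main : ∀ N : ℕ, {h : ℕ → ℕ | ∃ I ∈ F, s I < N ∧ h = hilbI k R 𝒜 I}.Finite := by
    intro N
    induction N with
    | zero => simp
    | succ N ih =>
      by_contra hinf
      have hinf' : ({h : ℕ → ℕ | ∃ I ∈ F, s I < N + 1 ∧ h = hilbI k R 𝒜 I} \
          {hilbI k R 𝒜 ⊥}).Infinite :=
        Set.Infinite.sdiff hinf (Set.finite_singleton _)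
      let f := hinf'.natEmbedding
      have hfI : ∀ m, ∃ I ∈ F, s I < N + 1 ∧ (f m : ℕ → ℕ) = hilbI k R 𝒜 I := fun m =>
        (f m).2.1
      choose I hIF hIs hfI using hfI
      have hIne : ∀ m, I m ≠ ⊥ := by
        intro m hm
        apply (f m).2.2
        rw [hfI, hm]
        rfl
      choose J hJF hJne x hxe hxI hIJ hJgen hN using fun m => hstep (I m) (hIF m) (hIne m)
      choose e hxe using hxe
      have hJI : ∀ m, J m ≤ I m := fun m => le_of_le_of_eq le_sup_left (hIJ m).symm
      have hed : ∀ m, e m ≤ d := by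
        intro m
        by_contra hc
        apply hJne m
        refine le_antisymm (hJI m) (le_of_low k R 𝒜 d _ _ (hdeg _ (hIF m)) ?_)
        intro j hj
        rw [low_step k R 𝒜 π h2 h4 (I m) (J m) (hpm _ (hJF m)) (x m) (e m) (hxe m) (hIJ m) j
          (by omega)]
        exact inf_le_right
      let U : Ultrafilter ℕ := Filter.hyperfilter ℕ
      obtain ⟨e0, -, he0⟩ := (Ultrafilter.eventually_exists_mem_iff (f := U)
        (is := Set.Iic d) (P := fun c m => e m = c) (Set.finite_Iic _)).1
        (Filter.Eventually.of_forall fun m => ⟨_, hed m, rfl⟩)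
      obtain ⟨hJ0, -, hhJ0⟩ := (Ultrafilter.eventually_exists_mem_iff (f := U)
        (P := fun c m => hilbI k R 𝒜 (J m) = c) ih).1
        (Filter.Eventually.of_forall fun m => ⟨_, ⟨J m, hJF m, by
          have := hslt (I m) (hIF m) (J m) (hJI m) (hJne m)
          have := hIs m
          omega, rfl⟩, rfl⟩)
      obtain ⟨gI, hgI, hgI'⟩ := hlim U I hIF
      obtain ⟨gN, hgN, hgN'⟩ := hlim U (fun m => colon R (x m) (J m)) hN
      have hst : ∀ m j, e m ≤ j →
          hilbI k R 𝒜 (I m) j + hilbI k R 𝒜 (colon R (x m) (J m)) (j - e m) =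
            hilbI k R 𝒜 (J m) j + hilbA k R 𝒜 (j - e m) := fun m j hj =>
        hilb_step k R 𝒜 hlf hmul π h1 h2 h3 (I m) (J m) (hpm _ (hJF m)) (x m) (e m) (hxe m)
          (hIJ m) j hj
      have hlow : ∀ m j, ¬ e m ≤ j → hilbI k R 𝒜 (I m) j = hilbI k R 𝒜 (J m) j := by
        intro m j hj
        unfold hilbI
        rw [low_step k R 𝒜 π h2 h4 (I m) (J m) (hpm _ (hJF m)) (x m) (e m) (hxe m) (hIJ m) j hj]
      have hge : ∀ᶠ m in U, hilbI k R 𝒜 (I m) = gI := by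
        filter_upwards [he0, hhJ0, hgI', hgN'] with m a1 a2 a3 a4
        funext j
        obtain ⟨m', b1, b2, b3, b4⟩ :=
          (he0.and (hhJ0.and ((hgI j).and (hgN (j - e0))))).exists
        have c3 := a3 j
        have c4 := a4 (j - e0)
        by_cases hj : e0 ≤ j
        · have d1 := hst m j (by omega)
          have d2 := hst m' j (by omega)
          rw [a1, a2] at d1
          rw [b1, b2] at d2
          omega
        · have d1 := hlow m j (by omega)
          have d2 := hlow m' j (by omega)
          rw [a2] at d1
          rw [b2] at d2
          omega
      refine Set.Finite.notMem_hyperfilter (α := ℕ) ?_ hge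
      refine Set.Subsingleton.finite ?_
      intro a ha b hb
      apply f.injective
      apply Subtype.ext
      rw [hfI, hfI]
      exact Eq.trans ha (Eq.symm hb)
  refine (main (∑ j ∈ Finset.range (d + 1), hilbA k R 𝒜 j + 1)).subset ?_
  rintro h ⟨I, hI, rfl⟩
  refine ⟨I, hI, ?_, rfl⟩
  refine Nat.lt_succ_of_le (Finset.sum_le_sum fun j _ => ?_)
  exact Submodule.finrank_mono inf_le_left

end NCG
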